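/- Let k be a field of characteristic 0 with algebraic closure k̄, S = k[x_0,...,x_n], I ∈ Hilb^μ(k), and let u ∈ S_1 be a linear form. Then (I : u) = I if and only if u does not vanish at any point defined by the extension of I to k̄[x_0,...,x_n]; concretely, (I : u) = I if and only if u(a) ≠ 0 for every nonzero a ∈ k̄^{n+1} such that f(a) = 0 for all f ∈ I. -/

import Mathlib

open MvPolynomial

noncomputable section

/-- `S_d`: the homogeneous component of degree `d` of `S = k[x_0, …, x_n]`. -/
def homogComp (n : ℕ) (k : Type*) [CommRing k] (d : ℕ) :
    Submodule k (MvPolynomial (Fin (n + 1)) k) :=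
  homogeneousSubmodule (Fin (n + 1)) k d

/-- The quotient `S_d / (N ∩ S_d)`; for `N` the underlying module of a homogeneous
ideal `I` this is `S_d / I_d`. -/
def quotComp {n : ℕ} {k : Type*} [CommRing k]
    (N : Submodule k (MvPolynomial (Fin (n + 1)) k)) (d : ℕ) :=
  homogComp n k d ⧸ N.comap (homogComp n k d).subtype

instance {n : ℕ} {k : Type*} [CommRing k]
    (N : Submodule k (MvPolynomial (Fin (n + 1)) k)) (d : ℕ) :
    AddCommGroup (quotComp N d) := by unfold quotComp; infer_instance

instance {n : ℕ} {k : Type*} [CommRing k]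
    (N : Submodule k (MvPolynomial (Fin (n + 1)) k)) (d : ℕ) :
    Module k (quotComp N d) := by unfold quotComp; infer_instance

/-- An ideal of `S = k[x_0, …, x_n]` is homogeneous if it contains all the homogeneous
components of its elements. -/
def IsHomogeneousIdeal {n : ℕ} {k : Type*} [CommRing k]
    (I : Ideal (MvPolynomial (Fin (n + 1)) k)) : Prop :=
  ∀ f ∈ I, ∀ d : ℕ, homogeneousComponent d f ∈ I

/-- A homogeneous ideal `I ⊆ S` is saturated if `I : (x_0, …, x_n) = I`. -/
def IsSaturatedIdeal {n : ℕ} {k : Type*} [CommRing k]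
    (I : Ideal (MvPolynomial (Fin (n + 1)) k)) : Prop :=
  ∀ f : MvPolynomial (Fin (n + 1)) k, (∀ i : Fin (n + 1), X i * f ∈ I) → f ∈ I

/-- `I ∈ Hilb^μ(k)` for a field `k`: `I` is a saturated homogeneous ideal of
`S = k[x_0, …, x_n]` with `dim_k (S_d / I_d) = μ` for every `d ≥ μ`. -/
def MemHilbField {n : ℕ} {k : Type*} [Field k] (μ : ℕ)
    (I : Ideal (MvPolynomial (Fin (n + 1)) k)) : Prop :=
  IsHomogeneousIdeal I ∧ IsSaturatedIdeal I ∧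
    ∀ d : ℕ, μ ≤ d → Module.finrank k (quotComp (I.restrictScalars k) d) = μ


namespace MvPolynomial

theorem homogeneousComponent_succ_mul {σ R : Type*} [CommSemiring R] {u : MvPolynomial σ R}
    (hu : u.IsHomogeneous 1) (f : MvPolynomial σ R) (d : ℕ) :
    homogeneousComponent (d + 1) (u * f) = u * homogeneousComponent d f := by
  have h (i : ℕ) : homogeneousComponent (d + 1) (u * homogeneousComponent i f) =
      if i = d then u * homogeneousComponent i f else 0 := by
    rw [homogeneousComponent_of_mem (n := i + 1)]
    · simp [eq_comm]
    · rw [add_comm]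
      exact hu.mul (homogeneousComponent_isHomogeneous i f)
  conv_lhs => rw [← sum_homogeneousComponent f, Finset.mul_sum, map_sum]
  simp only [h, Finset.sum_ite_eq', Finset.mem_range]
  split_ifs with hd
  · rfl
  · rw [homogeneousComponent_eq_zero d f (by omega), mul_zero]

end MvPolynomial

section

variable {n : ℕ} {k : Type*} [Field k] {I : Ideal (MvPolynomial (Fin (n + 1)) k)}
  {u : MvPolynomial (Fin (n + 1)) k}

/-- Multiplication by a linear form `u`, as a map `S_d / I_d → S_{d+1} / I_{d+1}`. -/
def quotCompMul (I : Ideal (MvPolynomial (Fin (n + 1)) k)) (hu : u.IsHomogeneous 1) (d : ℕ) :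
    (homogComp n k d ⧸ (I.restrictScalars k).comap (homogComp n k d).subtype) →ₗ[k]
      homogComp n k (d + 1) ⧸ (I.restrictScalars k).comap (homogComp n k (d + 1)).subtype :=
  Submodule.mapQ _ _
    ((LinearMap.mulLeft k u).restrict fun f (hf : f.IsHomogeneous d) ↦
      show (u * f).IsHomogeneous (d + 1) from add_comm 1 d ▸ hu.mul hf)
    fun f (hf : (f : MvPolynomial (Fin (n + 1)) k) ∈ I) ↦ I.mul_mem_left u hf

theorem quotCompMul_mk_eq_mk_iff (hu : u.IsHomogeneous 1) {d : ℕ} (f : homogComp n k d)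
    (g : homogComp n k (d + 1)) :
    quotCompMul I hu d (Submodule.Quotient.mk f) = Submodule.Quotient.mk g ↔
      u * (f : MvPolynomial (Fin (n + 1)) k) - g ∈ I :=
  Submodule.Quotient.eq _

theorem quotCompMul_injective_iff (hu : u.IsHomogeneous 1) (d : ℕ) :
    Function.Injective (quotCompMul I hu d) ↔
      ∀ f : MvPolynomial (Fin (n + 1)) k, f.IsHomogeneous d → u * f ∈ I → f ∈ I := by
  rw [injective_iff_map_eq_zero, (Submodule.mkQ_surjective _).forall]
  simp only [Submodule.mkQ_apply, ← Submodule.Quotient.mk_zero, quotCompMul_mk_eq_mk_iff]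
  simp only [Submodule.Quotient.mk_zero, Submodule.Quotient.mk_eq_zero, ZeroMemClass.coe_zero,
    sub_zero, Subtype.forall]
  rfl

theorem quotCompMul_surjective_iff (hu : u.IsHomogeneous 1) (d : ℕ) :
    Function.Surjective (quotCompMul I hu d) ↔
      ∀ g : MvPolynomial (Fin (n + 1)) k, g.IsHomogeneous (d + 1) →
        ∃ f : MvPolynomial (Fin (n + 1)) k, f.IsHomogeneous d ∧ u * f - g ∈ I := by
  rw [Function.Surjective, (Submodule.mkQ_surjective _).forall]
  simp only [(Submodule.mkQ_surjective _).exists, Submodule.mkQ_apply, quotCompMul_mk_eq_mk_iff,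
    Subtype.forall, Subtype.exists, exists_prop]
  rfl

theorem quotCompMul_injective_iff_surjective {μ : ℕ} (hμ : 0 < μ) (hI : MemHilbField μ I)
    (hu : u.IsHomogeneous 1) {d : ℕ} (hd : μ ≤ d) :
    Function.Injective (quotCompMul I hu d) ↔ Function.Surjective (quotCompMul I hu d) := by
  have h₁ : Module.finrank k
      (homogComp n k d ⧸ (I.restrictScalars k).comap (homogComp n k d).subtype) = μ :=
    hI.2.2 d hd
  have h₂ : Module.finrank k (homogComp n k (d + 1) ⧸
      (I.restrictScalars k).comap (homogComp n k (d + 1)).subtype) = μ :=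
    hI.2.2 (d + 1) (by omega)
  have := Module.finite_of_finrank_pos (h₁.symm ▸ hμ)
  have := Module.finite_of_finrank_pos (h₂.symm ▸ hμ)
  exact LinearMap.injective_iff_surjective_of_finrank_eq_finrank (h₁.trans h₂.symm)

/-- If a linear form `u` has no zero in common with `I` besides the origin, then a power of the
irrelevant ideal is contained in `I + (u)`. -/
theorem exists_idealOfVars_pow_le (kbar : Type*) [Field kbar] [Algebra k kbar] [IsAlgClosed kbar]
    (h : ∀ a : Fin (n + 1) → kbar, a ≠ 0 → (∀ f ∈ I, aeval a f = 0) → aeval a u ≠ 0) :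
    ∃ N : ℕ, idealOfVars (Fin (n + 1)) k ^ N ≤ I ⊔ Ideal.span {u} := by
  refine Ideal.exists_pow_le_of_le_radical_of_fg ?_ (IsNoetherian.noetherian _)
  rw [← vanishingIdeal_zeroLocus_eq_radical (K := kbar), idealOfVars, Ideal.span_le]
  rintro _ ⟨i, rfl⟩
  rw [SetLike.mem_coe, mem_vanishingIdeal_iff]
  intro a ha
  have ha₀ : a = 0 := by
    by_contra hne
    exact h a hne (fun f hf ↦ ha f (Ideal.mem_sup_left hf))
      (ha u (Ideal.mem_sup_right (Ideal.mem_span_singleton_self u)))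
  simp [ha₀]

theorem quotCompMul_surjective_of_idealOfVars_pow_le (hI : IsHomogeneousIdeal I)
    (hu : u.IsHomogeneous 1) {N d : ℕ}
    (hN : idealOfVars (Fin (n + 1)) k ^ N ≤ I ⊔ Ideal.span {u}) (hd : N ≤ d + 1) :
    Function.Surjective (quotCompMul I hu d) := by
  rw [quotCompMul_surjective_iff]
  intro g hg
  have hgN : g ∈ idealOfVars (Fin (n + 1)) k ^ N := by
    rw [mem_pow_idealOfVars_iff]
    intro m hm
    exact hd.trans_eq (hg.degree_eq_sum_deg_support hm)
  obtain ⟨i, hi, j, hj, hij⟩ := Submodule.mem_sup.1 (hN hgN)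
  obtain ⟨f, rfl⟩ := Ideal.mem_span_singleton.1 hj
  refine ⟨homogeneousComponent d f, homogeneousComponent_isHomogeneous d f, ?_⟩
  have hg' := congrArg (homogeneousComponent (d + 1)) hij
  rw [map_add, homogeneousComponent_succ_mul hu, homogeneousComponent_eq_self hg] at hg'
  rw [← hg', sub_add_cancel_right]
  exact I.neg_mem (hI i hi (d + 1))

/-- For a saturated homogeneous ideal, `(I : u) = I` can be checked in large degrees. -/
theorem mem_of_mul_mem_of_forall_ge (hI : IsHomogeneousIdeal I) (hsat : IsSaturatedIdeal I)
    (hu : u.IsHomogeneous 1) {N : ℕ}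
    (hN : ∀ d, N ≤ d →
      ∀ f : MvPolynomial (Fin (n + 1)) k, f.IsHomogeneous d → u * f ∈ I → f ∈ I)
    {f : MvPolynomial (Fin (n + 1)) k} (hf : u * f ∈ I) : f ∈ I := by
  have key (m : ℕ) : ∀ d, N ≤ d + m →
      ∀ g : MvPolynomial (Fin (n + 1)) k, g.IsHomogeneous d → u * g ∈ I → g ∈ I := by
    induction m with
    | zero => exact hN
    | succ m ih =>
      refine fun d hd g hg hug ↦ hsat g fun i ↦
        ih (d + 1) (by omega) _ (add_comm 1 d ▸ (isHomogeneous_X k i).mul hg) ?_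
      rw [mul_left_comm]
      exact I.mul_mem_left _ hug
  rw [← sum_homogeneousComponent f]
  refine I.sum_mem fun d _ ↦
    key N d (by omega) _ (homogeneousComponent_isHomogeneous d f) ?_
  rw [← homogeneousComponent_succ_mul hu]
  exact hI _ hf _

end

/-- Proposition `vanish`.
Let `k` be a field of characteristic 0 with algebraic closure `k̄`,
`S = k[x_0, …, x_n]`, `I ∈ Hilb^μ(k)` and `u ∈ S_1` a linear form.  Then `(I : u) = I`
if and only if `u` does not vanish at any point defined by the extension of `I` to
`k̄[x_0, …, x_n]`: concretely, `(I : u) = I` iff `u(a) ≠ 0` for every nonzero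
`a ∈ k̄^{n+1}` such that `f(a) = 0` for all `f ∈ I`. -/
theorem colon_eq_iff_not_vanish {k : Type*} [Field k] [CharZero k]
    (kbar : Type*) [Field kbar] [Algebra k kbar] [IsAlgClosure k kbar]
    {n μ : ℕ} (hμ : 0 < μ) (I : Ideal (MvPolynomial (Fin (n + 1)) k))
    (hI : MemHilbField μ I)
    (u : MvPolynomial (Fin (n + 1)) k) (hu : u ∈ homogComp n k 1) :
    (∀ f : MvPolynomial (Fin (n + 1)) k, u * f ∈ I → f ∈ I) ↔
      ∀ a : Fin (n + 1) → kbar, a ≠ 0 → (∀ f ∈ I, aeval a f = 0) →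
        aeval a u ≠ 0 := by
  have hu₁ : u.IsHomogeneous 1 := hu
  have : IsAlgClosed kbar := IsAlgClosure.isAlgClosed k
  constructor
  · intro h a ha haI hau
    have hsurj := (quotCompMul_injective_iff_surjective hμ hI hu₁ le_rfl).1
      ((quotCompMul_injective_iff hu₁ μ).2 fun f _ ↦ h f)
    obtain ⟨i, hi⟩ := Function.ne_iff.1 ha
    obtain ⟨f, -, hf⟩ := (quotCompMul_surjective_iff hu₁ μ).1 hsurj _
      (isHomogeneous_X_pow i (μ + 1))
    have := haI _ hf
    simp only [map_sub, map_mul, hau, zero_mul, map_pow, aeval_X, zero_sub, neg_eq_zero] at this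
    exact hi (pow_eq_zero_iff (Nat.succ_ne_zero μ) |>.1 this)
  · intro h f
    obtain ⟨N, hN⟩ := exists_idealOfVars_pow_le kbar h
    refine mem_of_mul_mem_of_forall_ge (N := max N μ) hI.1 hI.2.1 hu₁ fun d hd ↦ ?_
    rw [← quotCompMul_injective_iff hu₁,
      quotCompMul_injective_iff_surjective hμ hI hu₁ (le_of_max_le_right hd)]
    exact quotCompMul_surjective_of_idealOfVars_pow_le hI.1 hu₁ hN (by omega)

end
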